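/- arXiv:1508.07535 — 4 statements merged into one kernel-verified Lean document; each statement's English description precedes it below -/
import Mathlib

section
/- Let n ≥ 1, let ν ∈ (0, 1], and let γ : Fin n → ℝ satisfy 0 ≤ γ_i ≤ 1/(ν n) for all i and ∑_{i=1}^n γ_i = 1. Then the number of indices i with γ_i > 0 is at least ν n, i.e. (card {i : γ_i > 0} : ℝ) ≥ ν n. -/
/-- Proposition 1 (i), support vector part: ν is a lower bound on the fraction
of support vectors, i.e. the number of indices with γᵢ > 0 is at least ν n. -/
theorem frac_support_vectors_ge_nu
    (n : ℕ) (hn : 1 ≤ n) (ν : ℝ) (hν0 : 0 < ν) (hν1 : ν ≤ 1)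
    (γ : Fin n → ℝ)
    (hγ0 : ∀ i, 0 ≤ γ i) (hγub : ∀ i, γ i ≤ 1 / (ν * n))
    (hsum : ∑ i : Fin n, γ i = 1) :
    ν * n ≤ ((Finset.univ.filter (fun i : Fin n => 0 < γ i)).card : ℝ) := by
  have hνn : 0 < ν * n := mul_pos hν0 (by exact_mod_cast hn)
  have hsupp : ∑ i with 0 < γ i, γ i = 1 := by
    rw [← hsum]
    exact Finset.sum_filter_of_ne fun i _ hi => (hγ0 i).lt_of_ne' hi
  have hle := Finset.sum_le_card_nsmul (Finset.univ.filter fun i => 0 < γ i) γ _ fun i _ => hγub i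
  rwa [hsupp, nsmul_eq_mul, mul_one_div, one_le_div hνn] at hle
end

section
/- Let μ be a σ-finite measure on ℝ^d (e.g. Lebesgue measure), let h : ℝ^d → ℝ≥0 be measurable, and let P be the measure with density h with respect to μ, i.e. P(A) = ∫_A h dμ; assume P is a probability measure. Fix τ > 0 and set G = {x : h(x) ≥ τ}. Then for every measurable set A with P(A) ≥ P(G), one has μ(A) ≥ μ(G). In other words, G is a minimum volume set for its own mass: density level sets are MV sets. -/
open MeasureTheory
open scoped NNReal ENNReal

/-- Density level sets are Minimum Volume sets: any measurable set with at
least the mass of G = {h ≥ τ} has at least its volume. -/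
theorem level_set_is_MV_set
    (d : ℕ) (μ : Measure (Fin d → ℝ)) [SigmaFinite μ]
    (h : (Fin d → ℝ) → ℝ≥0) (hmeas : Measurable h)
    (P : Measure (Fin d → ℝ))
    (hP : P = μ.withDensity (fun x => (h x : ℝ≥0∞)))
    [IsProbabilityMeasure P]
    (τ : ℝ≥0) (hτ : 0 < τ)
    (A : Set (Fin d → ℝ)) (hA : MeasurableSet A)
    (hPA : P {x | τ ≤ h x} ≤ P A) :
    μ {x | τ ≤ h x} ≤ μ A := by
  set G : Set (Fin d → ℝ) := {x | τ ≤ h x}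
  have hG : MeasurableSet G := measurableSet_le measurable_const hmeas
  have hdiff : P (G \ A) ≤ P (A \ G) := by
    rw [← measure_inter_add_sdiff G hA, ← measure_inter_add_sdiff A hG, Set.inter_comm A G] at hPA
    exact (ENNReal.add_le_add_iff_left (measure_ne_top P _)).1 hPA
  have hlower : (τ : ℝ≥0∞) * μ (G \ A) ≤ P (G \ A) := by
    rw [hP, withDensity_apply _ (hG.diff hA), ← setLIntegral_const]
    exact setLIntegral_mono' (hG.diff hA) fun x hx => ENNReal.coe_le_coe.2 hx.1
  have hupper : P (A \ G) ≤ (τ : ℝ≥0∞) * μ (A \ G) := by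
    rw [hP, withDensity_apply _ (hA.diff hG), ← setLIntegral_const]
    exact setLIntegral_mono' (hA.diff hG) fun x hx =>
      ENNReal.coe_le_coe.2 (not_le.1 hx.2).le
  have hvol : μ (G \ A) ≤ μ (A \ G) :=
    (ENNReal.mul_le_mul_iff_right (ENNReal.coe_ne_zero.2 hτ.ne') ENNReal.coe_ne_top).1
      (hlower.trans (hdiff.trans hupper))
  rw [← measure_inter_add_sdiff G hA, ← measure_inter_add_sdiff A hG, Set.inter_comm A G]
  gcongr
end

section
/- Let μ be a σ-finite measure on ℝ^d, let h : ℝ^d → ℝ≥0 be measurable, and let P be the measure with density h with respect to μ; assume P is a probability measure. Fix τ > 0 and set G = {x : h(x) ≥ τ}. If A is a measurable set with P(A) ≥ P(G) and μ(A) ≤ μ(G), then μ(A Δ G) = 0, where A Δ G = (A \ G) ∪ (G \ A) is the symmetric difference. -/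
open MeasureTheory
open scoped NNReal ENNReal

/-- If `s` has finite measure and `μ s ≤ μ t`, then `s \ t` has at most the measure of `t \ s`. -/
theorem measure_diff_le_measure_diff_of_measure_le {α : Type*} [MeasurableSpace α]
    {μ : Measure α} {s t : Set α} (hs : MeasurableSet s) (ht : MeasurableSet t)
    (hfin : μ s ≠ ∞) (hst : μ s ≤ μ t) : μ (s \ t) ≤ μ (t \ s) := by
  have hinter : μ (s ∩ t) ≠ ∞ := measure_ne_top_of_subset Set.inter_subset_left hfin
  rw [← measure_inter_add_sdiff s ht, ← measure_inter_add_sdiff t hs, Set.inter_comm t s] at hst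
  exact (ENNReal.add_le_add_iff_left hinter).1 hst

/-- Uniqueness of MV sets up to null sets: a measurable set with at least the
mass and at most the volume of the level set G = {h ≥ τ} coincides with G up
to a μ-null set. -/
theorem MV_set_unique_up_to_null
    (d : ℕ) (μ : Measure (Fin d → ℝ)) [SigmaFinite μ]
    (h : (Fin d → ℝ) → ℝ≥0) (hmeas : Measurable h)
    (P : Measure (Fin d → ℝ))
    (hP : P = μ.withDensity (fun x => (h x : ℝ≥0∞)))
    [IsProbabilityMeasure P]
    (τ : ℝ≥0) (hτ : 0 < τ)
    (A : Set (Fin d → ℝ)) (hA : MeasurableSet A)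
    (hPA : P {x | τ ≤ h x} ≤ P A)
    (hμA : μ A ≤ μ {x | τ ≤ h x}) :
    μ ((A \ {x | τ ≤ h x}) ∪ ({x | τ ≤ h x} \ A)) = 0 := by
  set G : Set (Fin d → ℝ) := {x | τ ≤ h x}
  have hG : MeasurableSet G := measurableSet_le measurable_const hmeas
  have hτ₀ : (τ : ℝ≥0∞) ≠ 0 := by exact_mod_cast hτ.ne'
  have hP_apply {s : Set (Fin d → ℝ)} (hs : MeasurableSet s) : P s = ∫⁻ x in s, h x ∂μ := by
    rw [hP, withDensity_apply _ hs]
  have lower {s : Set (Fin d → ℝ)} (hs : MeasurableSet s) (hsG : s ⊆ G) : τ * μ s ≤ P s := by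
    rw [hP_apply hs, ← setLIntegral_const]
    exact setLIntegral_mono' hs fun x hx => by exact_mod_cast hsG hx
  have hμG : μ G ≠ ∞ := fun htop => by
    have hle := lower hG subset_rfl
    rw [htop, ENNReal.mul_top hτ₀, top_le_iff] at hle
    exact measure_ne_top P G hle
  have hμA_fin : μ A ≠ ∞ := ne_top_of_le_ne_top hμG hμA
  have hμ_diff : μ (A \ G) ≤ μ (G \ A) :=
    measure_diff_le_measure_diff_of_measure_le hA hG hμA_fin hμA
  have hP_diff : P (G \ A) ≤ P (A \ G) :=
    measure_diff_le_measure_diff_of_measure_le hG hA (measure_ne_top P G) hPA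
  have hAG : μ (A \ G) = 0 := by
    by_contra hne
    have hlt : P (A \ G) < τ * μ (A \ G) := by
      rw [hP_apply (hA.diff hG), ← setLIntegral_const]
      refine setLIntegral_strict_mono (hA.diff hG) hne measurable_const ?_ ?_
      · rw [← hP_apply (hA.diff hG)]
        exact measure_ne_top P _
      · exact ae_of_all _ fun x hx => by exact_mod_cast not_le.1 hx.2
    have hle : τ * μ (A \ G) ≤ P (A \ G) :=
      calc τ * μ (A \ G) ≤ τ * μ (G \ A) := by gcongr
        _ ≤ P (G \ A) := lower (hG.diff hA) Set.sdiff_subset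
        _ ≤ P (A \ G) := hP_diff
    exact hlt.not_ge hle
  have hGA : μ (G \ A) = 0 := by
    have hPAG : P (A \ G) = 0 := hP ▸ withDensity_absolutelyContinuous μ _ hAG
    have hle := (lower (hG.diff hA) Set.sdiff_subset).trans (hP_diff.trans hPAG.le)
    exact (mul_eq_zero.1 (nonpos_iff_eq_zero.1 hle)).resolve_left hτ₀
  exact measure_union_null hAG hGA
end

section
/- Let μ be a σ-finite measure on ℝ^d, let h : ℝ^d → ℝ≥0 be measurable with no flat parts, i.e. μ({x : h(x) = τ}) = 0 for all τ > 0, and let P be the measure with density h with respect to μ; assume P is a probability measure. Then for every α ∈ (0, 1) there exists τ_α > 0 such that the set G*_α = {x : h(x) ≥ τ_α} satisfies: (a) P(G*_α) = α, and (b) for every measurable set A with P(A) ≥ α, μ(A) ≥ μ(G*_α). That is, the minimum volume set problem min μ(G) subject to P(G) ≥ α admits a solution which is a density level set of mass exactly α. -/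
open MeasureTheory
open scoped NNReal ENNReal

/-- The upper tail of a finite measure along a function with null fibres is continuous. -/
theorem continuous_measure_superlevel {X : Type*} [MeasurableSpace X] (P : Measure X)
    [IsFiniteMeasure P] {h : X → ℝ≥0} (hmeas : Measurable h)
    (hnull : ∀ t, P {x | h x = t} = 0) : Continuous fun t => P {x | t ≤ h x} := by
  have hset : ∀ t, MeasurableSet {x | t ≤ h x} := fun t => measurableSet_le measurable_const hmeas
  have heq : ∀ t, P {x | t ≤ h x} = ∫⁻ x, {x | t ≤ h x}.indicator 1 x ∂P := fun t =>
    (lintegral_indicator_one (hset t)).symm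
  simp_rw [heq]
  refine continuous_iff_continuousAt.2 fun t => ?_
  refine tendsto_lintegral_filter_of_dominated_convergence (fun _ => 1)
    (.of_forall fun s => measurable_one.indicator (hset s))
    (.of_forall fun s => .of_forall fun x => Set.indicator_le_self' (by simp) x) (by simp) ?_
  have hne : ∀ᵐ x ∂P, h x ≠ t := by simpa [ae_iff] using hnull t
  filter_upwards [hne] with x hx
  refine tendsto_const_nhds.congr' ?_
  rcases lt_or_gt_of_ne hx with hlt | hlt
  · filter_upwards [lt_mem_nhds hlt] with s hs
    simp [Set.indicator, hs.not_ge, hlt.not_ge]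
  · filter_upwards [gt_mem_nhds hlt] with s hs
    simp [Set.indicator, hs.le, hlt.le]

theorem tendsto_measure_superlevel_atTop {X : Type*} [MeasurableSpace X] (P : Measure X)
    [IsFiniteMeasure P] {h : X → ℝ≥0} (hmeas : Measurable h) :
    Filter.Tendsto (fun t => P {x | t ≤ h x}) Filter.atTop (nhds 0) := by
  have hInter : ⋂ t : ℝ≥0, {x | t ≤ h x} = ∅ := by
    refine Set.eq_empty_iff_forall_notMem.2 fun x hx => ?_
    exact (lt_add_one (h x)).not_ge (Set.mem_iInter.1 hx (h x + 1))
  have := tendsto_measure_iInter_atTop (μ := P) (s := fun t : ℝ≥0 => {x | t ≤ h x})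
    (fun t => (measurableSet_le measurable_const hmeas).nullMeasurableSet)
    (fun _ _ hst _ hx => hst.trans hx) ⟨0, measure_ne_top _ _⟩
  simpa [hInter, Function.comp_def] using this

/-- Density level sets minimize the volume among sets of at least the same mass. -/
theorem measure_superlevel_le_of_withDensity_le {X : Type*} [MeasurableSpace X] {μ : Measure X}
    {h : X → ℝ≥0} (hmeas : Measurable h) [IsFiniteMeasure (μ.withDensity fun x => (h x : ℝ≥0∞))]
    {τ : ℝ≥0} (hτ : 0 < τ) {A : Set X} (hA : MeasurableSet A)
    (hle : μ.withDensity (fun x => (h x : ℝ≥0∞)) {x | τ ≤ h x} ≤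
      μ.withDensity (fun x => (h x : ℝ≥0∞)) A) :
    μ {x | τ ≤ h x} ≤ μ A := by
  set P := μ.withDensity fun x => (h x : ℝ≥0∞) with hP
  set G := {x | τ ≤ h x} with hGdef
  have hG : MeasurableSet G := measurableSet_le measurable_const hmeas
  have hlower : (τ : ℝ≥0∞) * μ (G \ A) ≤ P (G \ A) := by
    rw [hP, withDensity_apply _ (hG.diff hA), ← setLIntegral_const]
    exact setLIntegral_mono' (hG.diff hA) fun x hx => ENNReal.coe_le_coe.2 hx.1
  have hupper : P (A \ G) ≤ (τ : ℝ≥0∞) * μ (A \ G) := by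
    rw [hP, withDensity_apply _ (hA.diff hG), ← setLIntegral_const]
    exact setLIntegral_mono' (hA.diff hG) fun x hx => ENNReal.coe_le_coe.2 (not_le.1 hx.2).le
  have hmid : P (G \ A) ≤ P (A \ G) := by
    rw [← measure_inter_add_sdiff G hA, ← measure_inter_add_sdiff A hG, Set.inter_comm A G] at hle
    exact (ENNReal.add_le_add_iff_left (measure_ne_top P _)).1 hle
  have hdiff : μ (G \ A) ≤ μ (A \ G) :=
    (ENNReal.mul_le_mul_iff_right (by simpa using hτ.ne') ENNReal.coe_ne_top).1
      (hlower.trans (hmid.trans hupper))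
  rw [← measure_inter_add_sdiff G hA, ← measure_inter_add_sdiff A hG, Set.inter_comm A G]
  gcongr


/-- Existence of a Minimum Volume set: under the no-flat-parts assumption, for
every α ∈ (0,1) there is a level τ_α > 0 such that G*_α = {h ≥ τ_α} has mass
exactly α and minimal volume among measurable sets of mass at least α. -/
theorem exists_MV_set
    (d : ℕ) (μ : Measure (Fin d → ℝ)) [SigmaFinite μ]
    (h : (Fin d → ℝ) → ℝ≥0) (hmeas : Measurable h)
    (hflat : ∀ τ : ℝ≥0, 0 < τ → μ {x | h x = τ} = 0)
    (P : Measure (Fin d → ℝ))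
    (hP : P = μ.withDensity (fun x => (h x : ℝ≥0∞)))
    [IsProbabilityMeasure P]
    (α : ℝ≥0∞) (hα0 : 0 < α) (hα1 : α < 1) :
    ∃ τ : ℝ≥0, 0 < τ ∧ P {x | τ ≤ h x} = α ∧
      ∀ A : Set (Fin d → ℝ), MeasurableSet A → α ≤ P A →
        μ {x | τ ≤ h x} ≤ μ A := by
  subst hP
  set P := μ.withDensity fun x => (h x : ℝ≥0∞) with hP
  have hnull : ∀ t, P {x | h x = t} = 0 := by
    intro t
    rcases eq_or_ne t 0 with rfl | ht
    · rw [hP, withDensity_apply_eq_zero hmeas.coe_nnreal_ennreal]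
      convert measure_empty (μ := μ)
      ext x
      simp
    · exact withDensity_absolutelyContinuous _ _ (hflat t (pos_iff_ne_zero.2 ht))
  have hzero : P {x | 0 ≤ h x} = 1 := by simp
  obtain ⟨s, hs⟩ :=
    ((tendsto_measure_superlevel_atTop P hmeas).eventually (gt_mem_nhds hα0)).exists
  obtain ⟨τ, hτ⟩ : α ∈ Set.range fun t => P {x | t ≤ h x} :=
    mem_range_of_exists_le_of_exists_ge (continuous_measure_superlevel P hmeas hnull)
      ⟨s, hs.le⟩ ⟨0, hα1.le.trans_eq hzero.symm⟩
  have hτ0 : 0 < τ := by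
    refine pos_iff_ne_zero.2 ?_
    rintro rfl
    exact hα1.ne (hτ.symm.trans hzero)
  exact ⟨τ, hτ0, hτ, fun A hA hαA =>
    measure_superlevel_le_of_withDensity_le hmeas hτ0 hA (hτ.le.trans hαA)⟩
end
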